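/- arXiv:2005.04561 — 2 statements merged into one kernel-verified Lean document; each statement's English description precedes it below -/
import Mathlib

section
/- For all integers n, l ≥ 0 with n ≠ l and n + l ≥ 1, the function t ↦ J_n(t) J_l(t)/t is integrable on (0, ∞) and ∫_0^∞ (1/t) J_n(t) J_l(t) dt = (2/π) · sin((π/2)(n − l)) / (n² − l²). -/
open Real MeasureTheory

/-- Bessel function of the first kind of nonnegative integer order n:
J_n(t) = Σ_{m=0}^∞ ((−1)^m/(m!(n+m)!)) (t/2)^{n+2m}. -/
noncomputable def besselJ (n : ℕ) (t : ℝ) : ℝ :=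
  ∑' m : ℕ, ((-1 : ℝ) ^ m / ((m.factorial : ℝ) * ((n + m).factorial : ℝ))) * (t / 2) ^ (n + 2 * m)


namespace BesselAux

open Filter Topology

/-- coefficient function -/
noncomputable def gT (n m : ℕ) (x : ℝ) : ℝ :=
  ((-1 : ℝ) ^ m / ((m.factorial : ℝ) * ((n + m).factorial : ℝ))) * x ^ m

noncomputable def g (n : ℕ) (x : ℝ) : ℝ := ∑' m : ℕ, gT n m x

lemma coef_bound (n m : ℕ) :
    ‖(-1 : ℝ) ^ m / ((m.factorial : ℝ) * ((n + m).factorial : ℝ))‖ ≤ 1 / (m.factorial : ℝ) := by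
  have h1 : (1 : ℝ) ≤ ((n + m).factorial : ℝ) := by exact_mod_cast Nat.succ_le_of_lt (Nat.factorial_pos _)
  have h2 : (0 : ℝ) < (m.factorial : ℝ) := by positivity
  have h3 : ‖(m.factorial : ℝ) * ((n + m).factorial : ℝ)‖ = (m.factorial : ℝ) * ((n + m).factorial : ℝ) := by
    rw [Real.norm_eq_abs, abs_of_pos (by positivity)]
  rw [norm_div, h3, norm_pow, norm_neg, norm_one, one_pow]
  gcongr
  nlinarith

lemma gT_bound (n m : ℕ) (x : ℝ) : ‖gT n m x‖ ≤ |x| ^ m / (m.factorial : ℝ) := by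
  unfold gT
  rw [norm_mul, norm_pow, Real.norm_eq_abs x]
  calc _ ≤ 1 / (m.factorial : ℝ) * |x| ^ m := by gcongr; exact coef_bound n m
    _ = _ := by ring

lemma summable_norm_gT (n : ℕ) (x : ℝ) : Summable fun m => ‖gT n m x‖ :=
  Summable.of_nonneg_of_le (fun _ => norm_nonneg _) (fun m => gT_bound n m x)
    (Real.summable_pow_div_factorial |x|)

lemma summable_gT (n : ℕ) (x : ℝ) : Summable fun m => gT n m x :=
  (summable_norm_gT n x).of_norm

lemma hasDerivAt_g (n : ℕ) (x : ℝ) : HasDerivAt (g n) (- g (n + 1) x) x := by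
  set R := |x| + 1 with hR
  have key := hasDerivAt_tsum_of_isPreconnected (𝕜 := ℝ)
    (u := fun m : ℕ => (m : ℝ) * (R ^ (m - 1) / (m.factorial : ℝ)))
    (g := fun m x => gT n m x)
    (g' := fun m y => ((-1 : ℝ) ^ m / ((m.factorial : ℝ) * ((n + m).factorial : ℝ))) * (m * y ^ (m - 1)))
    (t := Metric.ball 0 R) (y₀ := 0) (y := x) ?_ Metric.isOpen_ball
    (convex_ball 0 R).isPreconnected ?_ ?_ (by simp [hR]; positivity) (summable_gT n 0) (by simp [hR])
  · have : (∑' m : ℕ, ((-1 : ℝ) ^ m / ((m.factorial : ℝ) * ((n + m).factorial : ℝ))) * (m * x ^ (m - 1)))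
        = - g (n + 1) x := by
      rw [tsum_eq_zero_add']
      · simp only [g, ← tsum_neg]
        simp only [Nat.cast_zero, zero_mul, mul_zero, zero_add]
        congr 1
        ext m
        simp only [gT, Nat.add_sub_cancel, Nat.factorial_succ, pow_succ]
        rw [show n + 1 + m = n + (m + 1) by ring]
        have : (m.factorial : ℝ) ≠ 0 := by positivity
        have : ((n + (m + 1)).factorial : ℝ) ≠ 0 := by positivity
        push_cast
        field_simp
      · have := (summable_gT (n + 1) x).neg
        refine this.congr ?_
        intro m
        simp only [gT, Nat.add_sub_cancel, Nat.factorial_succ, pow_succ]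
        rw [show n + 1 + m = n + (m + 1) by ring]
        have : (m.factorial : ℝ) ≠ 0 := by positivity
        have : ((n + (m + 1)).factorial : ℝ) ≠ 0 := by positivity
        push_cast
        field_simp
    rw [← this]
    exact key
  · rw [← summable_nat_add_iff 1]
    refine (Real.summable_pow_div_factorial R).congr ?_
    intro m
    simp only [Nat.add_sub_cancel, Nat.factorial_succ]
    push_cast
    have : (m.factorial : ℝ) ≠ 0 := by positivity
    field_simp
  · intro m y _
    exact (hasDerivAt_pow m y).const_mul _
  · intro m y hy
    have hy' : |y| ≤ R := by simpa using (Metric.mem_ball.1 hy).le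
    have h5 : ‖(m : ℝ) * y ^ (m - 1)‖ = m * |y| ^ (m - 1) := by
      rw [norm_mul, norm_pow, Real.norm_eq_abs y, Real.norm_eq_abs, abs_of_nonneg (by positivity)]
    rw [norm_mul, h5]
    have h4 : |y| ^ (m - 1) ≤ R ^ (m - 1) := by gcongr
    calc _ ≤ 1 / (m.factorial : ℝ) * (m * R ^ (m - 1)) := by
          gcongr
          exact coef_bound n m
      _ = _ := by ring

lemma g_rec (n : ℕ) (x : ℝ) : g n x + x * g (n + 2) x = (n + 1) * g (n + 1) x := by
  have h0 : g n x = gT n 0 x + ∑' m, gT n (m + 1) x := (summable_gT n x).tsum_eq_zero_add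
  have h1 : g (n + 1) x = gT (n + 1) 0 x + ∑' m, gT (n + 1) (m + 1) x :=
    (summable_gT (n + 1) x).tsum_eq_zero_add
  have s0 : Summable fun m => gT n (m + 1) x := (summable_nat_add_iff 1).2 (summable_gT n x)
  have s1 : Summable fun m => gT (n + 2) m x := summable_gT _ x
  rw [h0, h1, mul_add, ← tsum_mul_left, add_assoc, show g (n + 2) x = ∑' m, gT (n + 2) m x from rfl,
    ← tsum_mul_left, ← Summable.tsum_add s0 (s1.mul_left x)]
  congr 1
  · simp only [gT, Nat.factorial_succ, Nat.add_zero]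
    have : (n.factorial : ℝ) ≠ 0 := by positivity
    push_cast
    field_simp
  · congr 1
    ext m
    simp only [gT]
    rw [show n + 2 + m = (n + m + 1) + 1 by ring, show n + 1 + (m + 1) = (n + m + 1) + 1 by ring,
      show n + (m + 1) = n + m + 1 by ring]
    simp only [Nat.factorial_succ, pow_succ]
    have : ((n + m).factorial : ℝ) ≠ 0 := by positivity
    have : (m.factorial : ℝ) ≠ 0 := by positivity
    push_cast
    field_simp
    ring

lemma bessel_eq (n : ℕ) (t : ℝ) : besselJ n t = (t / 2) ^ n * g n ((t / 2) ^ 2) := by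
  unfold besselJ g gT
  rw [← tsum_mul_left]
  congr 1
  ext m
  rw [pow_add, pow_mul]
  ring

lemma hasDerivAt_bessel (n : ℕ) {t : ℝ} (ht : t ≠ 0) :
    HasDerivAt (besselJ n) (n / t * besselJ n t - besselJ (n + 1) t) t := by
  have e : besselJ n = fun t => (t / 2) ^ n * g n ((t / 2) ^ 2) := funext (bessel_eq n)
  rw [e]
  have h1 : HasDerivAt (fun t : ℝ => t / 2) (1 / 2) t := (hasDerivAt_id t).div_const 2
  have h2 : HasDerivAt (fun t : ℝ => g n ((t / 2) ^ 2)) (- g (n + 1) ((t / 2) ^ 2) * (2 * (t / 2) ^ 1 * (1 / 2))) t :=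
    HasDerivAt.comp (h₂ := g n) (h := fun t : ℝ => (t / 2) ^ 2) t (hasDerivAt_g n ((t / 2) ^ 2))
      ((h1.pow 2).congr_deriv (by norm_num))
  have h3 := (h1.pow n).mul h2
  refine h3.congr_deriv ?_
  simp only [bessel_eq]
  rcases n with _ | n
  · simp; ring
  · simp [pow_succ]
    field_simp
    ring

lemma differentiable_bessel (n : ℕ) : Differentiable ℝ (besselJ n) := by
  have e : besselJ n = fun t => (t / 2) ^ n * g n ((t / 2) ^ 2) := funext (bessel_eq n)
  have : Differentiable ℝ (g n) := fun x => (hasDerivAt_g n x).differentiableAt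
  rw [e]
  fun_prop

lemma continuous_bessel (n : ℕ) : Continuous (besselJ n) := (differentiable_bessel n).continuous

lemma bessel_rec (n : ℕ) {t : ℝ} (ht : t ≠ 0) :
    besselJ (n + 2) t = 2 * (n + 1) / t * besselJ (n + 1) t - besselJ n t := by
  have := g_rec n ((t / 2) ^ 2)
  simp only [bessel_eq]
  have e : 2 * ((n : ℝ) + 1) / t * ((t / 2) ^ (n + 1) * g (n + 1) ((t / 2) ^ 2)) =
    (t / 2) ^ n * ((n + 1) * g (n + 1) ((t / 2) ^ 2)) := by
    rw [pow_succ]; field_simp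
  rw [e, ← this]
  ring

lemma hasDerivAt_bessel_succ (n : ℕ) {t : ℝ} (ht : t ≠ 0) :
    HasDerivAt (besselJ (n + 1)) (besselJ n t - (n + 1) / t * besselJ (n + 1) t) t := by
  convert hasDerivAt_bessel (n + 1) ht using 1
  rw [bessel_rec n ht]
  push_cast
  field_simp
  ring

lemma bessel_zero_pos {n : ℕ} (hn : n ≠ 0) : besselJ n 0 = 0 := by
  rw [bessel_eq]; simp [hn]

/-- The Wronskian-type function. -/
noncomputable def W (n l : ℕ) (t : ℝ) : ℝ :=
  ((l : ℝ) - n) * (besselJ n t * besselJ l t) +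
    t * (besselJ l t * besselJ (n + 1) t - besselJ n t * besselJ (l + 1) t)

lemma hasDerivAt_W (n l : ℕ) {t : ℝ} (ht : t ≠ 0) :
    HasDerivAt (W n l) (((l : ℝ) ^ 2 - n ^ 2) * (besselJ n t * besselJ l t / t)) t := by
  have a := hasDerivAt_bessel n ht
  have b := hasDerivAt_bessel l ht
  have c := hasDerivAt_bessel_succ n ht
  have d := hasDerivAt_bessel_succ l ht
  have := ((a.mul b).const_mul ((l : ℝ) - n)).add ((hasDerivAt_id t).mul ((b.mul c).sub (a.mul d)))
  refine this.congr_deriv ?_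
  simp
  field_simp
  ring

lemma continuous_W (n l : ℕ) : Continuous (W n l) := by
  have := continuous_bessel
  unfold W
  fun_prop

lemma W_zero {n l : ℕ} (h : n ≠ l) : W n l 0 = 0 := by
  unfold W
  by_cases hn : n = 0
  · have : l ≠ 0 := by omega
    simp [bessel_zero_pos this]
  · simp [bessel_zero_pos hn]

lemma W01 {t : ℝ} (ht : t ≠ 0) :
    W 0 1 t = t * (besselJ 0 t ^ 2 + besselJ 1 t ^ 2) - besselJ 0 t * besselJ 1 t := by
  have := bessel_rec 0 ht
  simp only [zero_add] at this
  simp only [W, zero_add, Nat.reduceAdd, this]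
  push_cast
  field_simp
  ring

lemma energy_bound : ∃ C : ℝ, 0 ≤ C ∧ ∀ t : ℝ, 1 ≤ t →
    t * (besselJ 0 t ^ 2 + besselJ 1 t ^ 2) ≤ C := by
  have lower : ∀ t : ℝ, 1 ≤ t → t / 2 * (besselJ 0 t ^ 2 + besselJ 1 t ^ 2) ≤ W 0 1 t := by
    intro t ht
    rw [W01 (by positivity)]
    nlinarith [sq_nonneg (besselJ 0 t - besselJ 1 t), sq_nonneg (besselJ 0 t + besselJ 1 t),
      mul_nonneg (sub_nonneg.2 ht) (add_nonneg (sq_nonneg (besselJ 0 t)) (sq_nonneg (besselJ 1 t)))]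
  have hder : ∀ t : ℝ, 1 ≤ t → HasDerivAt (fun t => W 0 1 t * Real.exp (t⁻¹))
      (besselJ 0 t * besselJ 1 t / t * Real.exp (t⁻¹) + W 0 1 t * (Real.exp (t⁻¹) * (-(t ^ 2)⁻¹))) t := by
    intro t ht
    have h0 : t ≠ 0 := by positivity
    have h := (hasDerivAt_W 0 1 h0).mul ((hasDerivAt_inv h0).exp)
    refine h.congr_deriv ?_
    push_cast
    ring
  have anti : AntitoneOn (fun t => W 0 1 t * Real.exp (t⁻¹)) (Set.Ici 1) := by
    refine antitoneOn_of_deriv_nonpos (convex_Ici 1) ?_ ?_ ?_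
    · intro t ht
      exact (hder t ht).continuousAt.continuousWithinAt
    · intro t ht
      rw [interior_Ici] at ht
      exact (hder t (le_of_lt ht)).differentiableAt.differentiableWithinAt
    · intro t ht
      rw [interior_Ici] at ht
      have ht : 1 ≤ t := le_of_lt ht
      rw [(hder t ht).deriv]
      have h1 := lower t ht
      have h2 : besselJ 0 t * besselJ 1 t / t ≤ W 0 1 t * (t ^ 2)⁻¹ := by
        have ht0 : 0 < t := by positivity
        rw [div_le_iff₀ ht0]
        have : W 0 1 t * (t ^ 2)⁻¹ * t = W 0 1 t / t := by field_simp
        rw [this, le_div_iff₀ ht0]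
        nlinarith [sq_nonneg (besselJ 0 t - besselJ 1 t)]
      have h3 := Real.exp_pos (t⁻¹)
      nlinarith
  refine ⟨2 * (W 0 1 1 * Real.exp 1), ?_, ?_⟩
  · have := lower 1 le_rfl
    have : 0 ≤ W 0 1 1 := le_trans (by positivity) this
    positivity
  · intro t ht
    have h1 := lower t ht
    have h2 := anti (Set.self_mem_Ici) ht ht
    simp only [inv_one] at h2
    have h3 : 0 ≤ W 0 1 t := le_trans (by positivity) h1
    have h4 : 1 ≤ Real.exp (t⁻¹) := Real.one_le_exp (by positivity)
    nlinarith

/-- normalized -/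
noncomputable def v (n : ℕ) (t : ℝ) : ℝ := √t * besselJ n t

lemma v_rec (n : ℕ) {t : ℝ} (ht : t ≠ 0) : v (n + 2) t = 2 * (n + 1) / t * v (n + 1) t - v n t := by
  simp only [v, bessel_rec n ht]; ring

lemma v_bound (n : ℕ) : ∃ C : ℝ, 0 ≤ C ∧ ∀ t : ℝ, 1 ≤ t → |v n t| ≤ C := by
  obtain ⟨C, hC, h⟩ := energy_bound
  induction n using Nat.twoStepInduction with
  | zero =>
    refine ⟨√C, by positivity, fun t ht => Real.abs_le_sqrt ?_⟩
    rw [v, mul_pow, Real.sq_sqrt (by positivity)]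
    have := h t ht
    nlinarith [mul_nonneg (by positivity : 0 ≤ t) (sq_nonneg (besselJ 1 t))]
  | one =>
    refine ⟨√C, by positivity, fun t ht => Real.abs_le_sqrt ?_⟩
    rw [v, mul_pow, Real.sq_sqrt (by positivity)]
    have := h t ht
    nlinarith [mul_nonneg (by positivity : 0 ≤ t) (sq_nonneg (besselJ 0 t))]
  | more n h0 h1 =>
    obtain ⟨A, hA, h0⟩ := h0
    obtain ⟨B, hB, h1⟩ := h1
    refine ⟨2 * (n + 1) * B + A, by positivity, fun t ht => ?_⟩
    rw [v_rec n (by positivity)]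
    refine (abs_sub _ _).trans (add_le_add ?_ (h0 t ht))
    rw [abs_mul, abs_of_nonneg (by positivity)]
    have : 2 * ((n : ℝ) + 1) / t ≤ 2 * (n + 1) := div_le_self (by positivity) ht
    exact mul_le_mul this (h1 t ht) (abs_nonneg _) (by positivity)

lemma bounded_small (n : ℕ) : ∃ C : ℝ, 0 ≤ C ∧ ∀ t ∈ Set.Icc (0 : ℝ) 1, |besselJ n t| ≤ C := by
  obtain ⟨C, hC⟩ := isCompact_Icc.exists_bound_of_continuousOn (s := Set.Icc (0 : ℝ) 1) (continuous_bessel n).continuousOn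
  exact ⟨C, (norm_nonneg _).trans (hC 0 (by simp)), hC⟩

lemma bounded_small_div (n : ℕ) :
    ∃ C : ℝ, 0 ≤ C ∧ ∀ t ∈ Set.Ioc (0 : ℝ) 1, |besselJ (n + 1) t / t| ≤ C := by
  have hg : Continuous (g (n + 1)) := continuous_iff_continuousAt.2 fun x => (hasDerivAt_g (n + 1) x).continuousAt
  have hc : Continuous fun t : ℝ => (t / 2) ^ n / 2 * g (n + 1) ((t / 2) ^ 2) := by fun_prop
  obtain ⟨C, hC⟩ := isCompact_Icc.exists_bound_of_continuousOn (s := Set.Icc (0 : ℝ) 1) hc.continuousOn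
  refine ⟨C, (norm_nonneg _).trans (hC 0 (by simp)), fun t ht => ?_⟩
  have := hC t ⟨ht.1.le, ht.2⟩
  rw [Real.norm_eq_abs] at this
  convert this using 2
  rw [bessel_eq, pow_succ]
  have := ht.1.ne'
  field_simp

lemma integrable_of_bounds {f : ℝ → ℝ} (hf : Measurable f) {A B a : ℝ} (ha : a < -1)
    (h0 : ∀ t ∈ Set.Ioc (0 : ℝ) 1, |f t| ≤ A) (h1 : ∀ t : ℝ, 1 < t → |f t| ≤ B * t ^ a) :
    IntegrableOn f (Set.Ioi 0) := by
  rw [← Set.Ioc_union_Ioi_eq_Ioi (zero_le_one (α := ℝ))]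
  refine IntegrableOn.union ?_ ?_
  · refine Integrable.mono' (g := fun _ => A) (integrable_const _) hf.aestronglyMeasurable ?_
    exact (ae_restrict_iff' measurableSet_Ioc).2 (Eventually.of_forall h0)
  · refine Integrable.mono' (g := fun t => B * t ^ a)
      ((integrableOn_Ioi_rpow_of_lt ha one_pos).const_mul B) hf.aestronglyMeasurable ?_
    exact (ae_restrict_iff' measurableSet_Ioi).2 (Eventually.of_forall h1)

lemma bessel_large (n : ℕ) : ∃ C : ℝ, 0 ≤ C ∧ ∀ t : ℝ, 1 ≤ t → |besselJ n t| ≤ C * t ^ (-(1 / 2) : ℝ) := by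
  obtain ⟨C, hC, h⟩ := v_bound n
  refine ⟨C, hC, fun t ht => ?_⟩
  have ht0 : 0 < t := by positivity
  have := h t ht
  rw [v, abs_mul, abs_of_nonneg (by positivity)] at this
  rw [Real.rpow_neg ht0.le, ← Real.sqrt_eq_rpow, ← div_eq_mul_inv, le_div_iff₀ (by positivity)]
  linarith

lemma integrable_JJ' (n l : ℕ) :
    IntegrableOn (fun t : ℝ => besselJ n t * besselJ (l + 1) t / t) (Set.Ioi 0) := by
  obtain ⟨A, hA, hA'⟩ := bounded_small n
  obtain ⟨B, hB, hB'⟩ := bounded_small_div l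
  obtain ⟨C, hC, hC'⟩ := bessel_large n
  obtain ⟨D, hD, hD'⟩ := bessel_large (l + 1)
  refine integrable_of_bounds (A := A * B) (B := C * D) (a := -2) ?_ (by norm_num) ?_ ?_
  · exact ((continuous_bessel n).measurable.mul (continuous_bessel _).measurable).div measurable_id
  · intro t ht
    rw [mul_div_assoc, abs_mul]
    exact mul_le_mul (hA' t ⟨ht.1.le, ht.2⟩) (hB' t ht) (abs_nonneg _) hA
  · intro t ht
    have ht0 : 0 < t := by linarith
    rw [abs_div, abs_mul, abs_of_pos ht0]
    calc _ ≤ (C * t ^ (-(1 / 2) : ℝ)) * (D * t ^ (-(1 / 2) : ℝ)) / t := by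
          gcongr
          · exact hC' t ht.le
          · exact hD' t ht.le
      _ = C * D * (t ^ (-(1 / 2) : ℝ) * t ^ (-(1 / 2) : ℝ) * t ^ (-1 : ℝ)) := by
          rw [Real.rpow_neg_one]; ring
      _ = _ := by rw [← Real.rpow_add ht0, ← Real.rpow_add ht0]; norm_num

lemma integrable_JJ (n l : ℕ) (hsum : 1 ≤ n + l) :
    IntegrableOn (fun t : ℝ => besselJ n t * besselJ l t / t) (Set.Ioi 0) := by
  rcases l with _ | l
  · obtain ⟨k, rfl⟩ : ∃ k, n = k + 1 := ⟨n - 1, by omega⟩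
    simpa only [mul_comm] using integrable_JJ' 0 k
  · exact integrable_JJ' n l

lemma integrable_J1 : IntegrableOn (fun t : ℝ => besselJ 1 t / t) (Set.Ioi 0) := by
  obtain ⟨B, hB, hB'⟩ := bounded_small_div 0
  obtain ⟨D, hD, hD'⟩ := bessel_large 1
  refine integrable_of_bounds (A := B) (B := D) (a := -(3 / 2)) ?_ (by norm_num) hB' ?_
  · exact (continuous_bessel _).measurable.div measurable_id
  · intro t ht
    have ht0 : 0 < t := by linarith
    rw [abs_div, abs_of_pos ht0]
    calc _ ≤ (D * t ^ (-(1 / 2) : ℝ)) / t := by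
          gcongr
          · exact hD' t ht.le
      _ = D * (t ^ (-(1 / 2) : ℝ) * t ^ (-1 : ℝ)) := by
          rw [Real.rpow_neg_one]; ring
      _ = _ := by rw [← Real.rpow_add ht0]; norm_num

lemma v_bdd (n : ℕ) : IsBoundedUnder (· ≤ ·) atTop (fun t => ‖v n t‖) := by
  obtain ⟨C, hC, h⟩ := v_bound n
  exact isBoundedUnder_of_eventually_le (a := C) ((eventually_ge_atTop 1).mono h)

lemma v_asymp (n : ℕ) : Tendsto (fun t => v n t -
    (Real.cos (n * (π / 2)) * v 0 t + Real.sin (n * (π / 2)) * v 1 t)) atTop (𝓝 0) := by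
  induction n using Nat.twoStepInduction with
  | zero => simp
  | one => simp
  | more n h0 h1 =>
    have z : Tendsto (fun t => 2 * ((n : ℝ) + 1) / t * v (n + 1) t) atTop (𝓝 0) := by
      have hz : Tendsto (fun t : ℝ => 2 * ((n : ℝ) + 1) / t) atTop (𝓝 0) :=
        tendsto_const_nhds.div_atTop tendsto_id
      exact hz.zero_mul_isBoundedUnder_le (v_bdd (n + 1))
    have := z.sub h0
    rw [sub_zero] at this
    refine this.congr' ?_
    filter_upwards [eventually_gt_atTop 0] with t ht
    rw [v_rec n ht.ne']
    have e : ((n + 2 : ℕ) : ℝ) * (π / 2) = n * (π / 2) + π := by push_cast; ring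
    rw [e, Real.cos_add_pi, Real.sin_add_pi]
    ring

lemma bessel_tendsto (n : ℕ) : Tendsto (besselJ n) atTop (𝓝 0) := by
  have hz : Tendsto (fun t : ℝ => (√t)⁻¹) atTop (𝓝 0) :=
    tendsto_inv_atTop_zero.comp Real.tendsto_sqrt_atTop
  refine (hz.zero_mul_isBoundedUnder_le (v_bdd n)).congr' ?_
  filter_upwards [eventually_gt_atTop 0] with t ht
  have : √t ≠ 0 := (Real.sqrt_pos.2 ht).ne'
  simp only [v]
  field_simp

/-- leading part -/
noncomputable def c (n : ℕ) (t : ℝ) : ℝ :=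
  Real.cos (n * (π / 2)) * v 0 t + Real.sin (n * (π / 2)) * v 1 t

lemma v_mul_asymp (n l : ℕ) : Tendsto (fun t => v n t * v l t - c n t * c l t) atTop (𝓝 0) := by
  have h1 : Tendsto (fun t => v n t - c n t) atTop (𝓝 0) := v_asymp n
  have h2 : Tendsto (fun t => v l t - c l t) atTop (𝓝 0) := v_asymp l
  have a := h1.zero_mul_isBoundedUnder_le (v_bdd l)
  have b := h2.zero_mul_isBoundedUnder_le (v_bdd n)
  have d := h1.mul h2
  have := (a.add b).sub d
  simp only [add_zero, mul_zero, sub_zero] at this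
  refine this.congr ?_
  intro t
  ring

lemma W_tendsto {L : ℝ} (hL : Tendsto (fun t => v 0 t ^ 2 + v 1 t ^ 2) atTop (𝓝 L)) (n l : ℕ) :
    Tendsto (W n l) atTop (𝓝 (L * Real.sin ((l - n) * (π / 2)))) := by
  have a := v_mul_asymp l (n + 1)
  have b := v_mul_asymp n (l + 1)
  have d := ((bessel_tendsto n).mul (bessel_tendsto l)).const_mul ((l : ℝ) - n)
  have e := hL.mul_const (Real.sin ((l - n) * (π / 2)))
  have := (d.add (a.sub b)).add e
  simp only [mul_zero, sub_zero, zero_add] at this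
  refine this.congr' ?_
  filter_upwards [eventually_gt_atTop 0] with t ht
  have hs : ∀ i j, v i t * v j t = t * (besselJ i t * besselJ j t) := by
    intro i j
    simp only [v]
    rw [mul_mul_mul_comm, Real.mul_self_sqrt ht.le]
  have e1 : ((n + 1 : ℕ) : ℝ) * (π / 2) = n * (π / 2) + π / 2 := by push_cast; ring
  have e2 : ((l + 1 : ℕ) : ℝ) * (π / 2) = l * (π / 2) + π / 2 := by push_cast; ring
  simp only [hs, W, c, e1, e2, Real.cos_add_pi_div_two, Real.sin_add_pi_div_two, sub_mul, Real.sin_sub]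
  ring

lemma L_tendsto : Tendsto (fun t => v 0 t ^ 2 + v 1 t ^ 2) atTop
    (𝓝 (∫ t in Set.Ioi (0 : ℝ), besselJ 0 t * besselJ 1 t / t)) := by
  have hi := integrable_JJ 0 1 (by norm_num)
  have h1 := intervalIntegral_tendsto_integral_Ioi 0 hi tendsto_id
  have h2 := (bessel_tendsto 0).mul (bessel_tendsto 1)
  have h3 := h1.add h2
  simp only [mul_zero, add_zero] at h3
  refine h3.congr' ?_
  filter_upwards [eventually_gt_atTop 0] with t ht
  have := intervalIntegral.integral_eq_sub_of_hasDerivAt_of_le (a := 0) (b := t) (f := W 0 1)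
    (f' := fun t => besselJ 0 t * besselJ 1 t / t) ht.le (continuous_W 0 1).continuousOn ?_ ?_
  · rw [id, this, W_zero (by norm_num), W01 ht.ne']
    simp only [v, mul_pow, Real.sq_sqrt ht.le]
    ring
  · intro x hx
    refine (hasDerivAt_W 0 1 hx.1.ne').congr_deriv ?_
    push_cast
    ring
  · rw [intervalIntegrable_iff_integrableOn_Ioc_of_le ht.le]
    exact hi.mono_set Set.Ioc_subset_Ioi_self

lemma moment (m : ℕ) {b : ℝ} (hb : 0 < b) :
    ∫ t in Set.Ioi (0 : ℝ), t ^ (2 * m + 3) * Real.exp (-b * t ^ 2) = (m + 1).factorial / (2 * b ^ (m + 2)) := by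
  have h := integral_rpow_mul_exp_neg_mul_rpow (p := 2) (q := (2 * m + 3 : ℕ)) (b := b) (by norm_num)
    (by have : (0 : ℝ) ≤ (2 * m + 3 : ℕ) := by positivity
        linarith) hb
  simp only [Real.rpow_natCast, Real.rpow_two] at h
  rw [h]
  have e : (((2 * m + 3 : ℕ) : ℝ) + 1) / 2 = ((m + 1 : ℕ) : ℝ) + 1 := by push_cast; ring
  have e' : -(((2 * m + 3 : ℕ) : ℝ) + 1) / 2 = -((m + 2 : ℕ) : ℝ) := by push_cast; ring
  rw [e, e', Real.Gamma_nat_eq_factorial, Real.rpow_neg hb.le, Real.rpow_natCast]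
  field_simp

lemma moment_integrable (k : ℕ) {b : ℝ} (hb : 0 < b) :
    IntegrableOn (fun t : ℝ => t ^ k * Real.exp (-b * t ^ 2)) (Set.Ioi 0) := by
  have := integrableOn_rpow_mul_exp_neg_mul_rpow (p := 2) (s := k) (b := b)
    (by have : (0 : ℝ) ≤ k := by positivity
        linarith) (by norm_num) hb
  simpa only [Real.rpow_natCast, Real.rpow_two] using this

lemma gauss_J1 {b : ℝ} (hb : 0 < b) :
    ∫ t in Set.Ioi (0 : ℝ), besselJ 1 t * (t ^ 2 * Real.exp (-b * t ^ 2)) = Real.exp (-(1 / (4 * b))) / (4 * b ^ 2) := by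
  set F : ℕ → ℝ → ℝ := fun m t => ((-1 : ℝ) ^ m / ((m.factorial : ℝ) * ((1 + m).factorial : ℝ)) / 2 ^ (1 + 2 * m)) *
    (t ^ (2 * m + 3) * Real.exp (-b * t ^ 2)) with hF
  have e : ∀ t, besselJ 1 t * (t ^ 2 * Real.exp (-b * t ^ 2)) = ∑' m, F m t := by
    intro t
    rw [besselJ, ← tsum_mul_right]
    congr 1
    ext m
    simp only [hF, div_pow]
    ring
  simp only [e]
  have hval : ∀ m, ∫ t in Set.Ioi (0 : ℝ), F m t = 1 / (4 * b ^ 2) * ((-(1 / (4 * b))) ^ m / m.factorial) := by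
    intro m
    simp only [hF]
    rw [integral_const_mul, moment m hb, add_comm 1 m]
    have : ((m + 1).factorial : ℝ) ≠ 0 := by positivity
    have : (m.factorial : ℝ) ≠ 0 := by positivity
    rw [neg_pow (1 / (4 * b)), div_pow, mul_pow, pow_add 2 1, pow_mul]
    norm_num
    field_simp
    ring
  have hnorm : ∀ m, ∫ t in Set.Ioi (0 : ℝ), ‖F m t‖ = 1 / (4 * b ^ 2) * ((1 / (4 * b)) ^ m / m.factorial) := by
    intro m
    have : ∀ t ∈ Set.Ioi (0 : ℝ), ‖F m t‖ = (1 / ((m.factorial : ℝ) * ((1 + m).factorial : ℝ)) / 2 ^ (1 + 2 * m)) *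
        (t ^ (2 * m + 3) * Real.exp (-b * t ^ 2)) := by
      intro t ht
      have ht : 0 < t := ht
      simp only [hF]
      rw [norm_mul, norm_div, norm_div, norm_pow, norm_neg, norm_one, one_pow]
      congr 1
      · simp
      · exact Real.norm_of_nonneg (by positivity)
    rw [setIntegral_congr_fun measurableSet_Ioi this, integral_const_mul, moment m hb, add_comm 1 m]
    have : ((m + 1).factorial : ℝ) ≠ 0 := by positivity
    have : (m.factorial : ℝ) ≠ 0 := by positivity
    rw [div_pow, mul_pow, pow_add 2 1, pow_mul]
    norm_num
    field_simp
    ring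
  have hs := hasSum_integral_of_summable_integral_norm (μ := volume.restrict (Set.Ioi (0 : ℝ))) (F := F)
    (fun m => (moment_integrable _ hb).const_mul _) (by
      simp only [hnorm]
      exact (Real.summable_pow_div_factorial _).mul_left _)
  rw [← hs.tsum_eq]
  simp only [hval]
  rw [tsum_mul_left, Real.exp_eq_exp_ℝ, NormedSpace.exp_eq_tsum_div]
  ring

lemma moment_two {t : ℝ} (ht : 0 < t) :
    ∫ u in Set.Ioi (0 : ℝ), u ^ 2 * Real.exp (-t ^ 2 * u ^ 2) = √π / (4 * t ^ 3) := by
  have h := integral_rpow_mul_exp_neg_mul_rpow (p := 2) (q := (2 : ℕ)) (b := t ^ 2) (by norm_num)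
    (by norm_num) (by positivity)
  simp only [Real.rpow_natCast, Real.rpow_two] at h
  rw [h]
  have e : (((2 : ℕ) : ℝ) + 1) / 2 = 1 / 2 + 1 := by norm_num
  have e' : (t ^ 2) ^ (-(((2 : ℕ) : ℝ) + 1) / 2) = (t ^ 3)⁻¹ := by
    rw [← Real.rpow_natCast t 2, ← Real.rpow_mul ht.le, ← Real.rpow_natCast t 3, ← Real.rpow_neg ht.le]
    norm_num
  rw [e, e', Real.Gamma_add_one (by norm_num), Real.Gamma_one_half_eq]
  field_simp
  norm_num

lemma integral_inv_gauss :
    ∫ u in Set.Ioi (0 : ℝ), u ^ 2 * (Real.exp (-(1 / (4 * u ^ 2))) / (4 * (u ^ 2) ^ 2)) = √π / 4 := by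
  have h := integral_comp_rpow_Ioi (fun y : ℝ => Real.exp (-(1 / 4) * y ^ 2) / 4) (p := -1) (by norm_num)
  rw [integral_div, integral_gaussian_Ioi] at h
  have : √(π / (1 / 4)) / 2 = √π := by
    rw [show π / (1 / 4) = 2 ^ 2 * π by ring, Real.sqrt_mul (by norm_num), Real.sqrt_sq (by norm_num)]
    ring
  rw [this] at h
  rw [← h]
  refine setIntegral_congr_fun measurableSet_Ioi ?_
  intro u hu
  have hu : 0 < u := hu
  simp only [smul_eq_mul]
  rw [Real.rpow_neg_one, show (-1 - 1 : ℝ) = -((2 : ℕ) : ℝ) by norm_num, Real.rpow_neg hu.le, Real.rpow_natCast]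
  have : -(1 / 4) * u⁻¹ ^ 2 = -(1 / (4 * u ^ 2)) := by field_simp
  rw [this]
  norm_num
  field_simp

lemma integral_J1 : ∫ t in Set.Ioi (0 : ℝ), besselJ 1 t / t = 1 := by
  set f : ℝ → ℝ → ℝ := fun t u => besselJ 1 t * t ^ 2 * (u ^ 2 * Real.exp (-t ^ 2 * u ^ 2)) with hf
  have hcont : Continuous (Function.uncurry f) := by
    have := continuous_bessel 1
    simp only [hf, Function.uncurry_def]
    fun_prop
  have hint : Integrable (Function.uncurry f)
      ((volume.restrict (Set.Ioi (0 : ℝ))).prod (volume.restrict (Set.Ioi (0 : ℝ)))) := by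
    rw [integrable_prod_iff hcont.aestronglyMeasurable]
    constructor
    · refine (ae_restrict_iff' measurableSet_Ioi).2 (Eventually.of_forall ?_)
      intro t ht
      have ht : 0 < t := ht
      exact (moment_integrable 2 (b := t ^ 2) (by positivity)).const_mul (besselJ 1 t * t ^ 2)
    · refine IntegrableOn.congr_fun (f := fun t => √π / 4 * ‖besselJ 1 t / t‖)
        (integrable_J1.norm.const_mul _) ?_ measurableSet_Ioi
      intro t ht
      have ht : 0 < t := ht
      have : ∀ u : ℝ, ‖Function.uncurry f (t, u)‖ = (|besselJ 1 t| * t ^ 2) * (u ^ 2 * Real.exp (-t ^ 2 * u ^ 2)) := by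
        intro u
        simp only [hf, Function.uncurry_def]
        rw [norm_mul, norm_mul, Real.norm_eq_abs, Real.norm_of_nonneg (by positivity : 0 ≤ t ^ 2),
          Real.norm_of_nonneg (by positivity : 0 ≤ u ^ 2 * Real.exp (-t ^ 2 * u ^ 2))]
      simp only [this]
      rw [integral_const_mul, moment_two ht, norm_div, Real.norm_eq_abs, Real.norm_of_nonneg ht.le]
      field_simp
  have hswap := integral_integral_swap hint
  have e1 : ∫ t in Set.Ioi (0 : ℝ), ∫ u in Set.Ioi (0 : ℝ), f t u
      = √π / 4 * ∫ t in Set.Ioi (0 : ℝ), besselJ 1 t / t := by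
    rw [← integral_const_mul]
    refine setIntegral_congr_fun measurableSet_Ioi ?_
    intro t ht
    have ht : 0 < t := ht
    simp only [hf]
    rw [integral_const_mul, moment_two ht]
    field_simp
  have e2 : ∫ u in Set.Ioi (0 : ℝ), ∫ t in Set.Ioi (0 : ℝ), f t u = √π / 4 := by
    rw [← integral_inv_gauss]
    refine setIntegral_congr_fun measurableSet_Ioi ?_
    intro u hu
    have hu : 0 < u := hu
    simp only
    rw [← gauss_J1 (b := u ^ 2) (by positivity), ← integral_const_mul]
    congr 1
    ext t
    simp only [hf]
    rw [show -t ^ 2 * u ^ 2 = -u ^ 2 * t ^ 2 by ring]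
    ring
  rw [e1, e2] at hswap
  have : √π / 4 ≠ 0 := by positivity
  exact mul_left_cancel₀ this (by rw [hswap, mul_one])

lemma sin_int (m : ℕ) :
    ∫ x in (0 : ℝ)..π, Real.sin x ^ (2 * m) = π * (m.centralBinom / 4 ^ m) := by
  rw [integral_sin_pow_even]
  congr 1
  induction m with
  | zero => simp
  | succ m ih =>
    rw [Finset.prod_range_succ, ih]
    have h := Nat.succ_mul_centralBinom_succ m
    have h' : ((m : ℝ) + 1) * ((m + 1).centralBinom : ℝ) = 2 * (2 * m + 1) * (m.centralBinom : ℝ) := by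
      exact_mod_cast h
    have h2 : ((m + 1).centralBinom : ℝ) = 2 * (2 * m + 1) * (m.centralBinom : ℝ) / (m + 1) := by
      rw [← h']; field_simp
    rw [h2, pow_succ]
    field_simp
    ring

lemma vander (m : ℕ) (x : ℝ) :
    ∑ ij ∈ Finset.HasAntidiagonal.antidiagonal m, gT 0 ij.1 x * gT 1 ij.2 x =
      (-1 : ℝ) ^ m / ((m.factorial : ℝ) * ((1 + m).factorial : ℝ)) * ((m + 1).centralBinom / 2) * x ^ m := by
  have hc : ((m + 1).centralBinom : ℝ) / 2 = ((m + 1 + m).choose m : ℝ) := by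
    have h : (m + 1).centralBinom = 2 * (m + 1 + m).choose m := by
      rw [Nat.centralBinom, show 2 * (m + 1) = (2 * m + 1) + 1 by ring, Nat.choose_succ_succ,
        Nat.choose_symm_half, show m + 1 + m = 2 * m + 1 by ring]
      ring
    rw [h]; push_cast; ring
  rw [hc, Nat.add_choose_eq, Nat.cast_sum, Finset.mul_sum, Finset.sum_mul]
  refine Finset.sum_congr rfl ?_
  rintro ⟨i, j⟩ hij
  have hij : i + j = m := Finset.HasAntidiagonal.mem_antidiagonal.1 hij
  subst hij
  simp only [gT]
  have c1 : ((i + j).choose j : ℝ) = (i + j).factorial / (i.factorial * j.factorial) := by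
    rw [add_comm i j, Nat.cast_add_choose ℝ, mul_comm]
  have c2 : ((i + j + 1).choose i : ℝ) = (1 + (i + j)).factorial / (i.factorial * (1 + j).factorial) := by
    have := Nat.cast_add_choose ℝ (a := i) (b := 1 + j)
    rw [show i + (1 + j) = i + j + 1 by ring] at this
    rw [this, add_comm 1 (i + j)]
  have h1 : (i.factorial : ℝ) ≠ 0 := by positivity
  have h2 : (j.factorial : ℝ) ≠ 0 := by positivity
  have h3 : ((1 + j).factorial : ℝ) ≠ 0 := by positivity
  have h4 : ((i + j).factorial : ℝ) ≠ 0 := by positivity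
  have h5 : ((1 + (i + j)).factorial : ℝ) ≠ 0 := by positivity
  push_cast
  rw [c1, c2, zero_add, pow_add, pow_add]
  field_simp

lemma product_formula (t : ℝ) :
    π * (besselJ 0 t * besselJ 1 t) = ∫ θ in Set.Ioc 0 π, besselJ 1 (2 * Real.sin θ * t) * Real.sin θ := by
  set F : ℕ → ℝ → ℝ := fun m θ => (((-1 : ℝ) ^ m / ((m.factorial : ℝ) * ((1 + m).factorial : ℝ))) *
    (t * (t ^ 2) ^ m)) * Real.sin θ ^ (2 * (m + 1)) with hF
  have e : ∀ θ, besselJ 1 (2 * Real.sin θ * t) * Real.sin θ = ∑' m, F m θ := by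
    intro θ
    rw [besselJ, ← tsum_mul_right]
    congr 1
    ext m
    simp only [hF]
    rw [show 2 * Real.sin θ * t / 2 = Real.sin θ * t by ring]
    ring
  simp only [e]
  have hint : ∀ m, Integrable (F m) (volume.restrict (Set.Ioc 0 π)) := by
    intro m
    have hc : Continuous (F m) := by
      simp only [hF]
      fun_prop
    exact (hc.integrableOn_Icc (a := 0) (b := π)).mono_set Set.Ioc_subset_Icc_self
  have hs := hasSum_integral_of_summable_integral_norm (μ := volume.restrict (Set.Ioc 0 π)) (F := F) hint (by
      refine Summable.of_nonneg_of_le (fun m => integral_nonneg fun _ => norm_nonneg _) (fun m => ?_)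
        (((Real.summable_pow_div_factorial (t ^ 2)).mul_left |t|).mul_right π)
      have hb : ∀ θ, ‖F m θ‖ ≤ |t| * ((t ^ 2) ^ m / m.factorial) := by
        intro θ
        simp only [hF]
        have h1 : ‖Real.sin θ ^ (2 * (m + 1))‖ ≤ 1 := by
          rw [norm_pow]
          exact pow_le_one₀ (norm_nonneg _) (Real.abs_sin_le_one θ)
        have h2 : ‖t * (t ^ 2) ^ m‖ = |t| * (t ^ 2) ^ m := by
          rw [norm_mul, Real.norm_eq_abs, Real.norm_of_nonneg (by positivity)]
        rw [norm_mul, norm_mul, h2]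
        calc _ ≤ 1 / (m.factorial : ℝ) * (|t| * (t ^ 2) ^ m) * 1 := by
              gcongr
              exact coef_bound 1 m
          _ = _ := by ring
      calc _ ≤ ∫ θ in Set.Ioc 0 π, |t| * ((t ^ 2) ^ m / m.factorial) :=
            integral_mono (hint m).norm (integrable_const _) hb
        _ = _ := by
          simp [Real.pi_pos.le, mul_comm])
  rw [← hs.tsum_eq]
  have hval : ∀ m, ∫ θ in Set.Ioc 0 π, F m θ = π * (t / 2) *
      ∑ ij ∈ Finset.HasAntidiagonal.antidiagonal m, gT 0 ij.1 ((t / 2) ^ 2) * gT 1 ij.2 ((t / 2) ^ 2) := by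
    intro m
    rw [vander]
    simp only [hF]
    rw [integral_const_mul, ← intervalIntegral.integral_of_le Real.pi_pos.le, sin_int,
      div_pow, div_pow, pow_succ 4 m]
    norm_num
    field_simp
    norm_num
  simp only [hval]
  rw [tsum_mul_left, ← tsum_mul_tsum_eq_tsum_sum_antidiagonal_of_summable_norm (summable_norm_gT 0 _)
    (summable_norm_gT 1 _), bessel_eq, bessel_eq]
  simp only [g]
  ring

lemma integral_J1_scale {a : ℝ} (ha : 0 < a) (h : ℝ → ℝ) :
    ∫ t in Set.Ioi (0 : ℝ), h (a * t) / t = ∫ t in Set.Ioi (0 : ℝ), h t / t := by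
  have := integral_comp_mul_left_Ioi (fun t => h t / t) 0 ha
  rw [mul_zero, smul_eq_mul] at this
  have e : ∫ t in Set.Ioi (0 : ℝ), h (a * t) / t = a * ∫ t in Set.Ioi (0 : ℝ), h (a * t) / (a * t) := by
    rw [← integral_const_mul]
    congr 1
    ext t
    field_simp
  rw [e, this, ← mul_assoc, mul_inv_cancel₀ ha.ne', one_mul]

lemma integral_J0J1 : ∫ t in Set.Ioi (0 : ℝ), besselJ 0 t * besselJ 1 t / t = 2 / π := by
  set f : ℝ → ℝ → ℝ := fun t θ => besselJ 1 (2 * Real.sin θ * t) * Real.sin θ / t with hf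
  have hsin : ∀ᵐ θ ∂(volume.restrict (Set.Ioc 0 π)), 0 < Real.sin θ := by
    rw [← restrict_Ioo_eq_restrict_Ioc]
    exact (ae_restrict_iff' measurableSet_Ioo).2 (Eventually.of_forall fun θ hθ => Real.sin_pos_of_mem_Ioo hθ)
  have hmeas : Measurable (Function.uncurry f) := by
    have := (continuous_bessel 1).measurable
    simp only [hf, Function.uncurry_def]
    fun_prop
  have hint : Integrable (Function.uncurry f)
      ((volume.restrict (Set.Ioi (0 : ℝ))).prod (volume.restrict (Set.Ioc 0 π))) := by
    rw [integrable_prod_iff' hmeas.aestronglyMeasurable]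
    constructor
    · filter_upwards [hsin] with θ hθ
      have h := (integrableOn_Ioi_comp_mul_left_iff (fun t => besselJ 1 t / t) 0
        (show 0 < 2 * Real.sin θ by positivity)).2 (by rw [mul_zero]; exact integrable_J1)
      refine (h.const_mul (2 * Real.sin θ * Real.sin θ)).congr (Eventually.of_forall fun t => ?_)
      simp only [hf, Function.uncurry_def]
      field_simp
    · have : (fun θ => ∫ t in Set.Ioi (0 : ℝ), ‖Function.uncurry f (t, θ)‖) =ᵐ[volume.restrict (Set.Ioc 0 π)]
          fun θ => Real.sin θ * ∫ t in Set.Ioi (0 : ℝ), |besselJ 1 t| / t := by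
        filter_upwards [hsin] with θ hθ
        rw [← integral_J1_scale (show 0 < 2 * Real.sin θ by positivity) (fun t => |besselJ 1 t|),
          ← integral_const_mul]
        refine setIntegral_congr_fun measurableSet_Ioi ?_
        intro t ht
        have ht : 0 < t := ht
        simp only [hf, Function.uncurry_def]
        rw [norm_div, norm_mul, Real.norm_eq_abs, Real.norm_of_nonneg hθ.le, Real.norm_of_nonneg ht.le]
        ring
      rw [integrable_congr this]
      exact ((Real.continuous_sin.integrableOn_Icc (a := 0) (b := π)).mono_set
        Set.Ioc_subset_Icc_self).mul_const _
  have hswap := integral_integral_swap hint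
  have e1 : ∫ t in Set.Ioi (0 : ℝ), ∫ θ in Set.Ioc 0 π, f t θ =
      π * ∫ t in Set.Ioi (0 : ℝ), besselJ 0 t * besselJ 1 t / t := by
    rw [← integral_const_mul]
    congr 1
    ext t
    simp only [hf]
    rw [integral_div, ← product_formula, mul_div_assoc]
  have e2 : ∫ θ in Set.Ioc 0 π, ∫ t in Set.Ioi (0 : ℝ), f t θ = ∫ θ in Set.Ioc 0 π, Real.sin θ := by
    refine integral_congr_ae ?_
    filter_upwards [hsin] with θ hθ
    have h1 := integral_J1_scale (show 0 < 2 * Real.sin θ by positivity) (besselJ 1)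
    rw [integral_J1] at h1
    have : ∫ t in Set.Ioi (0 : ℝ), f t θ = Real.sin θ * ∫ t in Set.Ioi (0 : ℝ), besselJ 1 (2 * Real.sin θ * t) / t := by
      rw [← integral_const_mul]
      congr 1
      ext t
      simp only [hf]
      ring
    rw [this, h1, mul_one]
  rw [e1, e2, ← intervalIntegral.integral_of_le Real.pi_pos.le, integral_sin] at hswap
  rw [eq_div_iff Real.pi_pos.ne', mul_comm, hswap]
  norm_num

end BesselAux

/-- for integers n, l ≥ 0 with n ≠ l and n + l ≥ 1, the function
t ↦ J_n(t)J_l(t)/t is integrable on (0,∞) and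
∫_0^∞ J_n(t)J_l(t)/t dt = (2/π) sin((π/2)(n−l))/(n²−l²). -/
theorem stmt9 (n l : ℕ) (hnl : n ≠ l) (hsum : 1 ≤ n + l) :
    IntegrableOn (fun t : ℝ => besselJ n t * besselJ l t / t) (Set.Ioi 0) ∧
    ∫ t in Set.Ioi (0 : ℝ), besselJ n t * besselJ l t / t =
      (2 / π) * Real.sin (π / 2 * ((n : ℝ) - (l : ℝ))) / ((n : ℝ) ^ 2 - (l : ℝ) ^ 2) := by
  have hi := BesselAux.integrable_JJ n l hsum
  refine ⟨hi, ?_⟩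
  have hL := BesselAux.L_tendsto
  rw [BesselAux.integral_J0J1] at hL
  have h := integral_Ioi_of_hasDerivAt_of_tendsto (a := 0)
    (BesselAux.continuous_W n l).continuousWithinAt
    (fun x hx => BesselAux.hasDerivAt_W n l (ne_of_gt hx)) (hi.const_mul _) (BesselAux.W_tendsto hL n l)
  rw [integral_const_mul, BesselAux.W_zero hnl, sub_zero] at h
  have hne : (n : ℝ) ^ 2 - (l : ℝ) ^ 2 ≠ 0 := by
    intro h0
    have : (n : ℝ) ^ 2 = (l : ℝ) ^ 2 := by linarith
    have := (sq_eq_sq₀ (Nat.cast_nonneg n) (Nat.cast_nonneg l)).1 this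
    exact hnl (by exact_mod_cast this)
  rw [eq_div_iff hne]
  have e : ((l : ℝ) - n) * (π / 2) = -(π / 2 * ((n : ℝ) - l)) := by ring
  rw [e, Real.sin_neg] at h
  linarith
end

section
/- Exact Toeplitz wave expansion (Theorem 1 with R → ∞): let N be an odd positive integer, h = 1/(N+1), u_0 ∈ ℝ^N, and j a positive integer. Define the Toeplitz wave T(j) = Σ_{k=1}^N cos(2j sin(kπ/(2(N+1)))) T_k u_0. Then all infinite series below converge absolutely and T(j) = ( J_0(2j) + 2 Σ_{ρ=1}^∞ J_{4(N+1)ρ}(2j) ) ν_0 + Σ_{k=1}^{N−1} ( J_{2k}(2j) + Σ_{ρ=1}^∞ ( J_{4(N+1)ρ+2k}(2j) + J_{4(N+1)ρ−2k}(2j) ) ) ν_k − (1/(2(N+1))) ( α e + β cos(2j) w ), where α = e·u_0 and β = w·u_0. -/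
open Real Matrix

/-- Toeplitz part: (T_k)_{m,n} = h cos((m−n) k π h), h = 1/(N+1), 1-based k. -/
noncomputable def Tmat (N : ℕ) (k : Fin N) : Matrix (Fin N) (Fin N) ℝ :=
  fun m n => (1 / (N + 1)) * Real.cos (((m.1 : ℝ) - (n.1 : ℝ)) * (k.1 + 1) * π / (N + 1))

/-- The Toeplitz wave at time t = j Δt (with Δt = Δx):
T(j) = Σ_{k=1}^N cos(2j sin(kπ/(2(N+1)))) T_k u_0. -/
noncomputable def Twave (N : ℕ) (u0 : Fin N → ℝ) (j : ℕ) : Fin N → ℝ :=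
  ∑ k : Fin N,
    Real.cos (2 * (j : ℝ) * Real.sin ((k.1 + 1) * π / (2 * (N + 1)))) • (Tmat N k).mulVec u0

/-- ν_0 = u_0 and, for k ≥ 1, ν_k = (E_k + E_kᵀ) u_0, i.e.
(ν_k)_m = Σ_{n : |m−n| = k} (u_0)_n. -/
def nuvec (N : ℕ) (u0 : Fin N → ℝ) (k : ℕ) : Fin N → ℝ :=
  fun m => ∑ n : Fin N, if m.1 + k = n.1 ∨ n.1 + k = m.1 then u0 n else 0

/-- e = (1,…,1)ᵀ. -/
def evec (N : ℕ) : Fin N → ℝ := fun _ => 1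

/-- w_m = (−1)^{m+1} for 1-based m, i.e. (−1)^{m.1}. -/
def wvec (N : ℕ) : Fin N → ℝ := fun m => (-1 : ℝ) ^ m.1


noncomputable def Jz (n : ℤ) (z : ℝ) : ℝ := (-1) ^ (-n).toNat * besselJ n.natAbs z

def natPairEquiv : ℤ × ℕ ≃ ℕ × ℕ where
  toFun p := (p.1.toNat + p.2, (-p.1).toNat + p.2)
  invFun q := ((q.1 : ℤ) - q.2, min q.1 q.2)
  left_inv := by
    rintro ⟨n, m⟩
    ext <;> simp <;> omega
  right_inv := by
    rintro ⟨a, b⟩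
    ext <;> simp <;> omega

lemma hs_congr {α β : Type*} [AddCommMonoid β] [TopologicalSpace β] {f g : α → β} {a b : β}
    (h : HasSum f a) (hab : a = b) (hfg : ∀ x, f x = g x) : HasSum g b := by
  obtain rfl : f = g := funext hfg
  exact hab ▸ h

lemma exp_hasSum (y : ℂ) : HasSum (fun a : ℕ => y ^ a / (a.factorial : ℂ)) (Complex.exp y) := by
  rw [Complex.exp_eq_exp_ℂ]
  refine hs_congr (NormedSpace.exp_series_hasSum_exp' (𝕂 := ℂ) y) rfl (fun n => ?_)
  rw [smul_eq_mul, div_eq_mul_inv, mul_comm]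

lemma besselJ_summable (n : ℕ) (t : ℝ) : Summable (fun m : ℕ =>
    ((-1 : ℝ) ^ m / ((m.factorial : ℝ) * ((n + m).factorial : ℝ))) * (t / 2) ^ (n + 2 * m)) := by
  have h := (Real.summable_pow_div_factorial ((t/2)^2)).mul_left (|t/2| ^ n)
  refine Summable.of_norm_bounded h (fun m => ?_)
  rw [Real.norm_eq_abs, abs_mul, abs_div, abs_pow, abs_neg, abs_one, one_pow, abs_pow, pow_add,
    pow_mul, sq_abs]
  have h1 : (1:ℝ) ≤ ((n + m).factorial : ℝ) := by exact_mod_cast Nat.succ_le_of_lt (Nat.factorial_pos _)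
  have h2 : (0:ℝ) < (m.factorial : ℝ) := by exact_mod_cast Nat.factorial_pos _
  rw [abs_of_pos (by positivity)]
  have h3 : 1 / ((m.factorial : ℝ) * ((n + m).factorial : ℝ)) ≤ 1 / (m.factorial : ℝ) := by
    apply one_div_le_one_div_of_le h2
    nlinarith
  calc _ ≤ 1 / (m.factorial : ℝ) * (|t / 2| ^ n * ((t / 2) ^ 2) ^ m) := by gcongr
    _ = _ := by ring

lemma JA_term (z : ℝ) (x : ℂ) (hx : x ≠ 0) (n : ℤ) (m : ℕ) :
    ((-1) ^ (-n).toNat * x ^ n) * (((((-1 : ℝ) ^ m / ((m.factorial : ℝ) *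
      ((n.natAbs + m).factorial : ℝ))) * (z / 2) ^ (n.natAbs + 2 * m) : ℝ)) : ℂ)
    = ((z / 2 * x : ℂ) ^ (n.toNat + m) / ((n.toNat + m).factorial : ℂ)) *
      ((-(z / 2 * x⁻¹) : ℂ) ^ ((-n).toNat + m) / (((-n).toNat + m).factorial : ℂ)) := by
  rcases le_total 0 n with hn | hn
  · obtain ⟨a, rfl⟩ := Int.eq_ofNat_of_zero_le hn
    simp only [Int.toNat_natCast, Int.toNat_neg_natCast, Int.natAbs_natCast, zpow_natCast, mul_pow,
      neg_pow (z / 2 * x⁻¹ : ℂ), zero_add, inv_pow, pow_zero, one_mul]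
    push_cast
    rw [pow_add x]
    field_simp
    ring
  · obtain ⟨a, ha⟩ := Int.eq_ofNat_of_zero_le (neg_nonneg.2 hn)
    obtain rfl : n = -(a : ℤ) := by omega
    simp only [neg_neg, Int.toNat_natCast, Int.toNat_neg_natCast, Int.natAbs_neg, Int.natAbs_natCast,
      _root_.zpow_neg, zpow_natCast, mul_pow, neg_pow (z / 2 * x⁻¹ : ℂ), zero_add, inv_pow]
    push_cast
    rw [pow_add x]
    field_simp
    ring

lemma JA_fiber (z : ℝ) (x : ℂ) (hx : x ≠ 0) (n : ℤ) :
    HasSum (fun m : ℕ => ((z / 2 * x : ℂ) ^ (n.toNat + m) / ((n.toNat + m).factorial : ℂ)) *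
      ((-(z / 2 * x⁻¹) : ℂ) ^ ((-n).toNat + m) / (((-n).toNat + m).factorial : ℂ)))
      ((Jz n z : ℂ) * x ^ n) := by
  have hb := (Complex.hasSum_ofReal.2 (besselJ_summable n.natAbs z).hasSum).mul_left
    ((-1) ^ (-n).toNat * x ^ n)
  refine hs_congr hb ?_ (JA_term z x hx n)
  rw [Jz, besselJ, Complex.ofReal_mul, Complex.ofReal_pow, Complex.ofReal_neg, Complex.ofReal_one]
  ring

lemma hasSum_mul_pair (f g : ℕ → ℂ) (a b : ℂ) (hf : HasSum f a) (hg : HasSum g b) :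
    HasSum (fun p : ℕ × ℕ => f p.1 * g p.2) (a * b) := by
  have hs : Summable (fun p : ℕ × ℕ => f p.1 * g p.2) :=
    summable_mul_of_summable_norm hf.summable.norm hg.summable.norm
  exact HasSum.mul hf hg hs

lemma hasSum_mul_pair' (f g : ℕ → ℂ) (a b : ℂ) (hf : HasSum f a) (hg : HasSum g b) :
    HasSum (fun p : ℤ × ℕ => f (p.1.toNat + p.2) * g ((-p.1).toNat + p.2)) (a * b) := by
  have h := hasSum_mul_pair f g a b hf hg
  rw [← natPairEquiv.hasSum_iff] at h
  exact h

lemma JA_double (z : ℝ) (x : ℂ) :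
    HasSum (fun p : ℤ × ℕ => ((z / 2 * x : ℂ) ^ (p.1.toNat + p.2) / ((p.1.toNat + p.2).factorial : ℂ)) *
      ((-(z / 2 * x⁻¹) : ℂ) ^ ((-p.1).toNat + p.2) / (((-p.1).toNat + p.2).factorial : ℂ)))
      (Complex.exp (z / 2 * (x - x⁻¹))) := by
  have hs := hasSum_mul_pair' _ _ _ _ (exp_hasSum (z / 2 * x)) (exp_hasSum (-(z / 2 * x⁻¹)))
  rw [← Complex.exp_add, show (z / 2 * x + -(z / 2 * x⁻¹) : ℂ) = z / 2 * (x - x⁻¹) by ring] at hs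
  exact hs

lemma JA (z : ℝ) (x : ℂ) (hx : x ≠ 0) :
    HasSum (fun n : ℤ => (Jz n z : ℂ) * x ^ n) (Complex.exp (z / 2 * (x - x⁻¹))) :=
  (JA_double z x).prod_fiberwise (JA_fiber z x hx)

lemma Jz_summable (z : ℝ) : Summable (fun n : ℤ => Jz n z) := by
  have := (JA z 1 one_ne_zero).summable
  simp only [_root_.one_zpow, mul_one] at this
  exact_mod_cast this

lemma Jz_even (n : ℤ) (hn : Even n) (z : ℝ) : Jz n z = besselJ n.natAbs z := by
  rw [Jz, Even.neg_one_pow, one_mul]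
  obtain ⟨c, rfl⟩ := hn
  rcases le_total 0 c with h | h
  · rw [Int.toNat_of_nonpos (by omega)]; simp
  · exact ⟨(-c).toNat, by omega⟩

lemma orth (L : ℕ) (hL : 0 < L) (ζ : ℂ) (hζ : IsPrimitiveRoot ζ L) (n : ℤ) :
    ∑ k ∈ Finset.range L, (ζ ^ k) ^ n = if (L : ℤ) ∣ n then (L : ℂ) else 0 := by
  have h1 : ∀ k : ℕ, (ζ ^ k) ^ n = (ζ ^ n) ^ k := fun k => by
    rw [← zpow_natCast, ← zpow_natCast, ← _root_.zpow_mul, ← _root_.zpow_mul, mul_comm]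
  simp only [h1]
  split_ifs with h
  · rw [(hζ.zpow_eq_one_iff_dvd n).2 h]; simp
  · have h2 : ζ ^ n ≠ 1 := fun h' => h ((hζ.zpow_eq_one_iff_dvd n).1 h')
    rw [geom_sum_eq h2, ← h1, hζ.pow_eq_one]; simp

lemma sampled (z : ℝ) (L : ℕ) (hL : 0 < L) (ζ : ℂ) (hζ : IsPrimitiveRoot ζ L) (D : ℤ) :
    HasSum (fun ρ : ℤ => (Jz (D + L * ρ) z : ℂ) * L)
      (∑ k ∈ Finset.range L, Complex.exp (z / 2 * (ζ ^ k - (ζ ^ k)⁻¹)) * (ζ ^ k) ^ (-D)) := by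
  have hz : ζ ≠ 0 := hζ.ne_zero hL.ne'
  have h := hasSum_sum (s := Finset.range L) (fun k _ =>
    (JA z (ζ ^ k) (pow_ne_zero _ hz)).mul_right ((ζ ^ k) ^ (-D)))
  have h2 : (fun n : ℤ => ∑ k ∈ Finset.range L, (Jz n z : ℂ) * (ζ ^ k) ^ n * (ζ ^ k) ^ (-D))
      = fun n => (Jz n z : ℂ) * if (L : ℤ) ∣ n - D then (L : ℂ) else 0 := by
    funext n
    rw [← orth L hL ζ hζ, Finset.mul_sum]
    refine Finset.sum_congr rfl (fun k _ => ?_)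
    rw [mul_assoc, ← zpow_add₀ (pow_ne_zero _ hz), sub_eq_add_neg]
  rw [h2] at h
  have inj : Function.Injective (fun ρ : ℤ => D + L * ρ) := by
    intro a b hab
    have : (L : ℤ) ≠ 0 := by omega
    exact mul_left_cancel₀ this (add_left_cancel hab)
  rw [← inj.hasSum_iff] at h
  · refine hs_congr h rfl (fun ρ => ?_)
    simp
  · intro n hn
    rw [if_neg, mul_zero]
    rintro ⟨c, hc⟩
    exact hn ⟨c, by simp only; omega⟩

/-- period summation -/
lemma sampled_real (z : ℝ) (M : ℕ) (hM : 0 < M) (d : ℕ) :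
    HasSum (fun ρ : ℤ => Jz (2 * d + 4 * M * ρ) z)
      (1 / (4 * M) * ∑ k ∈ Finset.range (4 * M),
        Real.cos (z * Real.sin (k * π / (2 * M)) - 2 * d * (k * π / (2 * M)))) := by
  have hM' : (M : ℂ) ≠ 0 := by exact_mod_cast hM.ne'
  have hM'' : (M : ℝ) ≠ 0 := by exact_mod_cast hM.ne'
  have h := sampled z (4 * M) (by omega) _ (Complex.isPrimitiveRoot_exp (4 * M) (by omega)) (2 * d)
  have h2 := (Complex.hasSum_re h).mul_left (1 / (4 * M) : ℝ)
  refine hs_congr h2 (Eq.symm ?key) (fun ρ => ?_)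
  rotate_left
  · rw [← Complex.ofReal_natCast, ← Complex.ofReal_mul, Complex.ofReal_re]
    push_cast
    field_simp
  case key =>
    rw [Complex.re_sum]
    congr 1
    refine Finset.sum_congr rfl (fun k _ => ?_)
    rw [← Complex.exp_nat_mul]
    have e : ((k : ℂ) * (2 * π * Complex.I / ((4 * M : ℕ) : ℂ))) =
        ((k * π / (2 * M) : ℝ) : ℂ) * Complex.I := by
      push_cast; field_simp; ring
    rw [e]
    set θ : ℝ := k * π / (2 * M)
    have e2 : (z / 2 * (Complex.exp (θ * Complex.I) - (Complex.exp (θ * Complex.I))⁻¹) : ℂ)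
        = ((z * Real.sin θ : ℝ) : ℂ) * Complex.I := by
      rw [← Complex.exp_neg, ← neg_mul, Complex.exp_mul_I, Complex.exp_mul_I, Complex.cos_neg, Complex.sin_neg]
      push_cast
      ring
    rw [e2, ← Complex.exp_int_mul, ← Complex.exp_add]
    have e3 : (((z * Real.sin θ : ℝ) : ℂ) * Complex.I + ((-(2 * (d:ℤ)) : ℤ) : ℂ) * (θ * Complex.I))
       = ((z * Real.sin θ - 2 * d * θ : ℝ) : ℂ) * Complex.I := by
      push_cast; ring
    rw [e3, Complex.exp_ofReal_mul_I_re]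

lemma trigsum (z : ℝ) (M : ℕ) (hM : 0 < M) (d : ℕ) :
    ∑ k ∈ Finset.range (4 * M),
        Real.cos (z * Real.sin (k * π / (2 * M)) - 2 * d * (k * π / (2 * M)))
    = 4 * ∑ k ∈ Finset.range (M - 1),
        Real.cos (z * Real.sin ((k + 1) * π / (2 * M))) * Real.cos (d * (k + 1) * π / M)
      + 2 * (1 + Real.cos z * (-1) ^ d) := by
  have hM'' : (M : ℝ) ≠ 0 := by exact_mod_cast hM.ne'
  set f : ℕ → ℝ := fun k => Real.cos (z * Real.sin (k * π / (2 * M))) * Real.cos (d * k * π / M) with hf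
  rw [show 4 * M = 2 * M + 2 * M by ring, Finset.sum_range_add, ← Finset.sum_add_distrib]
  have h1 : ∀ k ∈ Finset.range (2 * M),
      Real.cos (z * Real.sin (k * π / (2 * M)) - 2 * d * (k * π / (2 * M))) +
      Real.cos (z * Real.sin ((2 * M + k : ℕ) * π / (2 * M)) - 2 * d * ((2 * M + k : ℕ) * π / (2 * M)))
      = 2 * f k := by
    intro k _
    have e1 : ((2 * M + k : ℕ) * π / (2 * M) : ℝ) = k * π / (2 * M) + π := by
      push_cast; field_simp; ring
    have e2 : (d * k * π / M : ℝ) = 2 * d * (k * π / (2 * M)) := by field_simp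
    simp only [hf]
    rw [e1, e2, Real.sin_add_pi]
    set θ : ℝ := k * π / (2 * M)
    rw [show z * -Real.sin θ - 2 * d * (θ + π) = -(z * Real.sin θ + 2 * d * θ) - d * (2 * π) by ring,
      Real.cos_sub_nat_mul_two_pi, Real.cos_neg, Real.cos_sub, Real.cos_add]
    ring
  rw [Finset.sum_congr rfl h1, ← Finset.mul_sum]
  have f0 : f 0 = 1 := by simp [hf]
  have fM : f M = Real.cos z * (-1) ^ d := by
    simp only [hf]
    rw [show (M * π / (2 * M) : ℝ) = π / 2 by field_simp, show (d * M * π / M : ℝ) = d * π by field_simp,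
      Real.sin_pi_div_two, Real.cos_nat_mul_pi, mul_one]
  have fsym : ∀ k, k ≤ 2 * M → f (2 * M - k) = f k := by
    intro k hk
    simp only [hf]
    rw [Nat.cast_sub hk]
    rw [show (((2 * M : ℕ) - k : ℝ) * π / (2 * M)) = π - k * π / (2 * M) by push_cast; field_simp,
      show (d * ((2 * M : ℕ) - k : ℝ) * π / M) = d * (2 * π) - d * k * π / M by push_cast; field_simp,
      Real.sin_pi_sub, Real.cos_nat_mul_two_pi_sub]
  obtain ⟨N, rfl⟩ : ∃ N, M = N + 1 := ⟨M - 1, by omega⟩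
  rw [show 2 * (N + 1) = (N + 1) + (N + 1) by ring, Finset.sum_range_add, Finset.sum_range_succ',
    Finset.sum_range_succ' (fun x => f (N + 1 + x)), f0, add_zero, fM]
  have h3 : ∑ k ∈ Finset.range N, f (N + 1 + (k + 1)) = ∑ k ∈ Finset.range N, f (k + 1) := by
    rw [← Finset.sum_range_reflect]
    refine Finset.sum_congr rfl (fun k hk => ?_)
    rw [Finset.mem_range] at hk
    rw [← fsym (k + 1) (by omega)]
    congr 1
    omega
  rw [h3, show N + 1 - 1 = N by omega]
  simp only [hf]
  push_cast
  ring

noncomputable def Acoef (z : ℝ) (M d : ℕ) : ℝ :=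
  besselJ (2 * d) z + ∑' ρ : ℕ, (besselJ (4 * M * (ρ + 1) + 2 * d) z
    + besselJ (4 * M * (ρ + 1) - 2 * d) z)

lemma bes_summable (z : ℝ) (g : ℕ → ℕ) (hg : Function.Injective g) :
    Summable (fun ρ => |besselJ (g ρ) z|) := by
  have h := (Jz_summable z).abs.comp_injective (i := fun ρ : ℕ => (g ρ : ℤ))
    (fun a b hab => hg (by simpa using hab))
  refine h.congr (fun ρ => ?_)
  simp [Function.comp, Jz]

lemma Acoef_eq (z : ℝ) (M : ℕ) (d : ℕ) (hd : d < M) :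
    1 / (M : ℝ) * ∑ k ∈ Finset.range (M - 1),
        Real.cos (z * Real.sin ((k + 1) * π / (2 * M))) * Real.cos (d * (k + 1) * π / M)
     = Acoef z M d - 1 / (2 * M) * (1 + Real.cos z * (-1) ^ d) := by
  have hM : 0 < M := by omega
  have hM'' : (M : ℝ) ≠ 0 := by exact_mod_cast hM.ne'
  have h := sampled_real z M hM d
  rw [trigsum z M hM d] at h
  have h2 := h.nat_add_neg
  rw [← hasSum_nat_add_iff' 1] at h2
  have h3 := h2.tsum_eq
  have e0 : Jz (2 * d) z = besselJ (2 * d) z := by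
    rw [Jz_even _ ⟨d, by ring⟩]; congr 1
  have h4 : Acoef z M d = _ := congrArg (fun s => besselJ (2 * d) z + s) (Eq.trans (tsum_congr (fun ρ => ?_)) h3)
  · rw [h4]
    simp only [Finset.sum_range_one, Nat.cast_zero, neg_zero, mul_zero, add_zero, e0]
    generalize (∑ k ∈ Finset.range (M - 1), _ : ℝ) = S
    field_simp
    ring
  · have : 4 * M * 1 ≤ 4 * M * (ρ + 1) := Nat.mul_le_mul_left _ (by omega)
    rw [Jz_even _ ⟨d + 2 * M * ((ρ + 1 : ℕ) : ℤ), by ring⟩,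
      Jz_even _ ⟨d + 2 * M * -((ρ + 1 : ℕ) : ℤ), by ring⟩]
    have a1 : ((2:ℤ) * d + 4 * M * ((ρ + 1 : ℕ) : ℤ)) = ((4 * M * (ρ + 1) + 2 * d : ℕ) : ℤ) := by
      push_cast; ring
    have a2 : ((2:ℤ) * d + 4 * M * -((ρ + 1 : ℕ) : ℤ)) = -((4 * M * (ρ + 1) - 2 * d : ℕ) : ℤ) := by
      rw [Nat.cast_sub (by omega)]
      push_cast; ring
    rw [a1, a2, Int.natAbs_neg, Int.natAbs_natCast, Int.natAbs_natCast]

lemma nu_pick (N : ℕ) (u0 : Fin N → ℝ) (A : ℕ → ℝ) (m : Fin N) :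
    ∑ k ∈ Finset.range N, A k * nuvec N u0 k m
      = ∑ n : Fin N, u0 n * A (max m.1 n.1 - min m.1 n.1) := by
  simp only [nuvec, Finset.mul_sum]
  rw [Finset.sum_comm]
  refine Finset.sum_congr rfl (fun n _ => ?_)
  rw [Finset.sum_eq_single (max m.1 n.1 - min m.1 n.1)]
  · rw [if_pos (by omega), mul_comm]
  · intro k _ hk
    rw [if_neg (by omega), mul_zero]
  · intro h
    exact absurd (Finset.mem_range.2 (by omega)) h

lemma Twave_eq (N : ℕ) (u0 : Fin N → ℝ) (j : ℕ) (m : Fin N) :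
    Twave N u0 j m = ∑ n : Fin N, u0 n * (Acoef (2 * j) (N + 1) (max m.1 n.1 - min m.1 n.1)
      - 1 / (2 * ((N : ℝ) + 1)) * (1 + Real.cos (2 * j) * ((-1) ^ m.1 * (-1) ^ n.1))) := by
  simp only [Twave, Finset.sum_apply, Pi.smul_apply, smul_eq_mul, mulVec, dotProduct, Finset.mul_sum]
  rw [Finset.sum_comm]
  refine Finset.sum_congr rfl (fun n _ => ?_)
  have h := Acoef_eq (2 * j) (N + 1) (max m.1 n.1 - min m.1 n.1) (by omega)
  have hs : ((-1 : ℝ)) ^ (max m.1 n.1 - min m.1 n.1) = (-1) ^ m.1 * (-1) ^ n.1 := by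
    rw [← pow_add]
    apply neg_one_pow_congr
    rw [Nat.even_sub (by omega), Nat.even_add]
    rcases le_total m.1 n.1 with h | h
    · rw [max_eq_right h, min_eq_left h]; tauto
    · rw [max_eq_left h, min_eq_right h]
  rw [hs] at h
  push_cast at h
  rw [← h, Finset.mul_sum, Finset.mul_sum, Finset.sum_range]
  refine Finset.sum_congr rfl (fun k _ => ?_)
  have hc : Real.cos (((m.1 : ℝ) - (n.1 : ℝ)) * (k.1 + 1) * π / (N + 1)) =
      Real.cos (((max m.1 n.1 - min m.1 n.1 : ℕ) : ℝ) * (k.1 + 1) * π / (N + 1)) := by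
    rcases le_total m.1 n.1 with h | h
    · rw [max_eq_right h, min_eq_left h, Nat.cast_sub h, ← Real.cos_neg]
      congr 1; ring
    · rw [max_eq_left h, min_eq_right h, Nat.cast_sub h]
  rw [Tmat, hc]
  ring

/-- Exact Toeplitz wave expansion (Theorem 1 with R → ∞): for odd
positive N and integer j ≥ 1, all Bessel series converge absolutely and
T(j) = (J_0(2j) + 2 Σ_{ρ≥1} J_{4(N+1)ρ}(2j)) ν_0
  + Σ_{k=1}^{N−1} (J_{2k}(2j) + Σ_{ρ≥1}(J_{4(N+1)ρ+2k}(2j) + J_{4(N+1)ρ−2k}(2j))) ν_k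
  − (1/(2(N+1)))(α e + β cos(2j) w), with α = e·u_0, β = w·u_0. -/
theorem stmt16 (N : ℕ) (hN : 0 < N) (hNodd : Odd N) (u0 : Fin N → ℝ)
    (j : ℕ) (hj : 1 ≤ j) :
    Summable (fun ρ : ℕ => |besselJ (4 * (N + 1) * (ρ + 1)) (2 * (j : ℝ))|) ∧
    (∀ k : ℕ, 1 ≤ k → k ≤ N - 1 →
      Summable (fun ρ : ℕ => |besselJ (4 * (N + 1) * (ρ + 1) + 2 * k) (2 * (j : ℝ))|) ∧
      Summable (fun ρ : ℕ => |besselJ (4 * (N + 1) * (ρ + 1) - 2 * k) (2 * (j : ℝ))|)) ∧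
    Twave N u0 j =
      (besselJ 0 (2 * (j : ℝ)) + 2 * ∑' ρ : ℕ, besselJ (4 * (N + 1) * (ρ + 1)) (2 * (j : ℝ)))
          • nuvec N u0 0
      + ∑ k ∈ Finset.range (N - 1),
          (besselJ (2 * (k + 1)) (2 * (j : ℝ))
            + ∑' ρ : ℕ, (besselJ (4 * (N + 1) * (ρ + 1) + 2 * (k + 1)) (2 * (j : ℝ))
                + besselJ (4 * (N + 1) * (ρ + 1) - 2 * (k + 1)) (2 * (j : ℝ))))
            • nuvec N u0 (k + 1)
      - (1 / (2 * ((N : ℝ) + 1)))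
          • ((evec N ⬝ᵥ u0) • evec N + ((wvec N ⬝ᵥ u0) * Real.cos (2 * (j : ℝ))) • wvec N) := by
  have inj1 : ∀ c : ℕ, Function.Injective (fun ρ : ℕ => 4 * (N + 1) * (ρ + 1) + c) := by
    intro c a b hab
    have h : 4 * (N + 1) * (a + 1) = 4 * (N + 1) * (b + 1) := by simpa using hab
    have := Nat.eq_of_mul_eq_mul_left (by omega) h
    omega
  have inj2 : ∀ k : ℕ, k ≤ N - 1 →
      Function.Injective (fun ρ : ℕ => 4 * (N + 1) * (ρ + 1) - 2 * k) := by
    intro k hk a b hab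
    simp only at hab
    have ha : 4 * (N + 1) * 1 ≤ 4 * (N + 1) * (a + 1) := Nat.mul_le_mul_left _ (by omega)
    have hb : 4 * (N + 1) * 1 ≤ 4 * (N + 1) * (b + 1) := Nat.mul_le_mul_left _ (by omega)
    have h : 4 * (N + 1) * (a + 1) = 4 * (N + 1) * (b + 1) := by omega
    have := Nat.eq_of_mul_eq_mul_left (by omega) h
    omega
  refine ⟨bes_summable _ _ (inj1 0), fun k _ hk =>
    ⟨bes_summable _ _ (inj1 (2 * k)), bes_summable _ _ (inj2 k hk)⟩, ?_⟩
  funext m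
  rw [Twave_eq]
  have h0 : besselJ 0 (2 * (j : ℝ)) + 2 * ∑' ρ : ℕ, besselJ (4 * (N + 1) * (ρ + 1)) (2 * (j : ℝ))
      = Acoef (2 * j) (N + 1) 0 := by
    rw [Acoef, ← tsum_mul_left]
    simp only [mul_zero, add_zero, Nat.sub_zero, two_mul]
  have h1 : ∀ k : ℕ, besselJ (2 * (k + 1)) (2 * (j : ℝ))
            + ∑' ρ : ℕ, (besselJ (4 * (N + 1) * (ρ + 1) + 2 * (k + 1)) (2 * (j : ℝ))
                + besselJ (4 * (N + 1) * (ρ + 1) - 2 * (k + 1)) (2 * (j : ℝ)))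
      = Acoef (2 * j) (N + 1) (k + 1) := fun k => rfl
  simp only [h0, h1, Pi.sub_apply, Pi.add_apply, Pi.smul_apply, Finset.sum_apply, smul_eq_mul]
  have h2 := nu_pick N u0 (Acoef (2 * j) (N + 1)) m
  obtain ⟨N', rfl⟩ : ∃ N', N = N' + 1 := ⟨N - 1, by omega⟩
  rw [Finset.sum_range_succ'] at h2
  rw [Nat.add_sub_cancel, add_comm (Acoef _ _ 0 * _), h2]
  simp only [evec, wvec, dotProduct, mul_sub, Finset.sum_sub_distrib, Finset.sum_mul, one_mul, mul_one,
    Finset.mul_sum]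
  congr 1
  rw [← Finset.sum_add_distrib, Finset.mul_sum]
  refine Finset.sum_congr rfl (fun n _ => ?_)
  ring
end
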